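/- There exists N such that for all n ≥ N and every p ∈ (0,1], the following holds for G ~ G_{n,p}: with probability at least 1 − 1/n², every set A ⊆ {1,…,n} with |A| = a satisfies: (i) if (log n)/(ap) ≥ 7/4, then e_G(A) ≤ (3/2)·a·log n; and (ii) if (log n)/(ap) ≤ 7/4, then e_G(A) ≤ 3a²p. -/

import Mathlib

open scoped Classical
open SimpleGraph

namespace EDHC

/-- Degree of a vertex (as cardinality of its neighbour set). -/
noncomputable def deg {V : Type} (G : SimpleGraph V) (v : V) : ℕ := (G.neighborSet v).ncard

/-- Minimum degree. -/
noncomputable def minDeg {V : Type} (G : SimpleGraph V) : ℕ := sInf (Set.range (deg G))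

/-- Maximum degree. -/
noncomputable def maxDeg {V : Type} (G : SimpleGraph V) : ℕ := sSup (Set.range (deg G))

/-- Number of edges of `G` with both endpoints in `S`. -/
noncomputable def eIn {V : Type} (G : SimpleGraph V) (S : Set V) : ℕ :=
  {e ∈ G.edgeSet | ∀ v ∈ e, v ∈ S}.ncard

/-- Number of edges of `G` with one endpoint in `S` and the other in `T`. -/
noncomputable def eBtw {V : Type} (G : SimpleGraph V) (S T : Set V) : ℕ :=
  {e ∈ G.edgeSet | ∃ a ∈ S, ∃ b ∈ T, e = s(a, b)}.ncard

/-- `G` is `(p, β)`-jumbled. -/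
def IsJumbled {V : Type} (G : SimpleGraph V) (p β : ℝ) : Prop :=
  ∀ S : Set V, |(eIn G S : ℝ) - p * ((S.ncard : ℝ) * ((S.ncard : ℝ) - 1) / 2)| ≤ β * S.ncard

/-- `G` is strongly `2`-jumping. -/
def StronglyTwoJumping (n : ℕ) (G : SimpleGraph (Fin n)) : Prop :=
  ∀ T : Set (Fin n), T.Nonempty →
    (∑ v ∈ (Set.toFinite T).toFinset, (deg G v : ℝ)) / (T.ncard : ℝ) ≥
      (minDeg G : ℝ) + min ((T.ncard : ℝ) - 1) ((Real.log n) ^ 2)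

/-- `G` is `p`-pseudorandom. -/
def IsPseudorandom (n : ℕ) (G : SimpleGraph (Fin n)) (p : ℝ) : Prop :=
  IsJumbled G p (2 * Real.sqrt (n * p * (1 - p))) ∧
  (∀ S T : Set (Fin n), Disjoint S T →
    ((1 / (S.ncard : ℝ) + 1 / (T.ncard : ℝ)) * Real.log n / p ≥ 7 / 2 →
      (eBtw G S T : ℝ) ≤ 2 * ((S.ncard : ℝ) + (T.ncard : ℝ)) * Real.log n) ∧
    ((1 / (S.ncard : ℝ) + 1 / (T.ncard : ℝ)) * Real.log n / p ≤ 7 / 2 →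
      (eBtw G S T : ℝ) ≤ 7 * (S.ncard : ℝ) * (T.ncard : ℝ) * p)) ∧
  (∀ S : Set (Fin n),
    (Real.log n / ((S.ncard : ℝ) * p) ≥ 7 / 4 → (eIn G S : ℝ) ≤ 2 * (S.ncard : ℝ) * Real.log n) ∧
    (Real.log n / ((S.ncard : ℝ) * p) ≤ 7 / 4 → (eIn G S : ℝ) ≤ 7 * (S.ncard : ℝ) ^ 2 * p / 2)) ∧
  ((n : ℝ) * p - 2 * Real.sqrt ((n : ℝ) * p * Real.log n) ≤ (minDeg G : ℝ) ∧
    (minDeg G : ℝ) ≤ (n : ℝ) * p - 200 * Real.sqrt ((n : ℝ) * p * (1 - p)) ∧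
    (maxDeg G : ℝ) ≤ (n : ℝ) * p + 2 * Real.sqrt ((n : ℝ) * p * Real.log n)) ∧
  StronglyTwoJumping n G

/-- `G` is `u`-jumping. -/
def IsJumping (n : ℕ) (G : SimpleGraph (Fin n)) (u : ℝ) : Prop :=
  ∃ x₀ : Fin n, deg G x₀ = minDeg G ∧
    ∀ x : Fin n, x ≠ x₀ → (deg G x : ℝ) ≥ (minDeg G : ℝ) + u

/-- `C` is a Hamilton cycle (on the whole vertex set `Fin n`). -/
def IsHamCycle {n : ℕ} (C : SimpleGraph (Fin n)) : Prop :=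
  ∃ (v : Fin n) (w : C.Walk v v), w.IsHamiltonianCycle ∧ C.edgeSet = {e | e ∈ w.edges}

/-- `G` has property `H`. -/
def HasPropertyH (n : ℕ) (G : SimpleGraph (Fin n)) : Prop :=
  ∃ HC : Fin (minDeg G / 2) → SimpleGraph (Fin n),
    (∀ i, HC i ≤ G ∧ IsHamCycle (HC i)) ∧
    (∀ i j, i ≠ j → Disjoint (HC i).edgeSet (HC j).edgeSet) ∧
    (Odd (minDeg G) →
      ∃ M : SimpleGraph (Fin n), M ≤ G ∧ (∀ v, deg M v ≤ 1) ∧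
        M.edgeSet.ncard = n / 2 ∧ ∀ i, Disjoint M.edgeSet (HC i).edgeSet)

/-- Probability of the event `A` under the binomial random graph `G_{n,p}`. -/
noncomputable def gnpProb (n : ℕ) (p : ℝ) (A : SimpleGraph (Fin n) → Prop) : ℝ :=
  ∑ G : SimpleGraph (Fin n),
    if A G then p ^ G.edgeSet.ncard * (1 - p) ^ (n.choose 2 - G.edgeSet.ncard) else 0


/-- Number of cycles of a 2-regular graph = number of connected components. -/
noncomputable def numCycles {V : Type} (F : SimpleGraph V) : ℕ := Nat.card F.ConnectedComponent

/-- `N` is a perfect matching on the whole vertex set. -/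
def IsPerfectMatchingGraph {n : ℕ} (N : SimpleGraph (Fin n)) : Prop :=
  ∀ v, ((N.neighborSet v).ncard) = 1

/-- `N` is a perfect pseudomatching: one vertex of degree 2, all others of degree 1. -/
def IsPerfectPseudomatching {n : ℕ} (N : SimpleGraph (Fin n)) : Prop :=
  ∃ w, ((N.neighborSet w).ncard) = 2 ∧ ∀ v, v ≠ w → ((N.neighborSet v).ncard) = 1

/-- A set of edges forms a matching (no two distinct edges share a vertex). -/
def IsMatchingSet {n : ℕ} (E : Set (Sym2 (Fin n))) : Prop :=
  ∀ e ∈ E, ∀ f ∈ E, e ≠ f → ∀ v : Fin n, v ∈ e → v ∉ f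

/-- Number of cycles (orbits, including fixed points) of a permutation. -/
noncomputable def cycleCount {α : Type} (σ : Equiv.Perm α) : ℕ :=
  Nat.card (Quotient (⟨σ.SameCycle,
    ⟨fun x => Equiv.Perm.SameCycle.refl σ x, fun h => h.symm, fun h h' => h.trans h'⟩⟩ : Setoid α))

/-- Edges of the bipartite graph given by the relation `R` between `S` and `T`. -/
noncomputable def eBip {n : ℕ} (R : Fin n → Fin n → Prop) (S T : Set (Fin n)) : ℕ :=
  {q : Fin n × Fin n | q.1 ∈ S ∧ q.2 ∈ T ∧ R q.1 q.2}.ncard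

/-- One rotation of a path (represented as a list of vertices), with new edge from `H`
and pivot in `Q`. -/
def RotStep {V : Type} (H : SimpleGraph V) (Q : Set V) (l l' : List V) : Prop :=
  ∃ (x : V) (a : List V) (p : V) (b : List V),
    l = (x :: a) ++ p :: b ∧ l' = (x :: a).reverse ++ p :: b ∧ p ∈ Q ∧ H.Adj x p

/-- `v` is `(H, Q, τ)`-reachable from the path `l`. -/
def ReachableVert {V : Type} (H : SimpleGraph V) (Q : Set V) (τ : ℕ) (l : List V) (v : V) : Prop :=
  ∃ (k : ℕ) (f : ℕ → List V), k ≤ τ ∧ f 0 = l ∧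
    (∀ i < k, RotStep H Q (f i) (f (i + 1))) ∧ (f k).head? = some v

/-- External neighbourhood. -/
def extNbhd {V : Type} (H : SimpleGraph V) (S : Set V) : Set V :=
  (⋃ x ∈ S, H.neighborSet x) \ S

end EDHC

namespace EDHC

/-- The probability of a single graph `G` under `G_{n,p}`. -/
noncomputable def gnpWeight (n : ℕ) (p : ℝ) (G : SimpleGraph (Fin n)) : ℝ :=
  p ^ G.edgeSet.ncard * (1 - p) ^ (n.choose 2 - G.edgeSet.ncard)

lemma gnpWeight_nonneg {n : ℕ} {p : ℝ} (hp : 0 ≤ p) (hp1 : p ≤ 1) (G : SimpleGraph (Fin n)) :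
    0 ≤ gnpWeight n p G :=
  mul_nonneg (pow_nonneg hp _) (pow_nonneg (sub_nonneg.2 hp1) _)

lemma gnpProb_eq_sum_gnpWeight (n : ℕ) (p : ℝ) (P : SimpleGraph (Fin n) → Prop) :
    gnpProb n p P = ∑ G : SimpleGraph (Fin n), if P G then gnpWeight n p G else 0 := rfl

/-- The sum over all graphs of a product weight factorizes over the edges. -/
lemma sum_gnpWeight_mul_prod (n : ℕ) (p : ℝ) (f : Sym2 (Fin n) → ℝ) :
    ∑ G : SimpleGraph (Fin n), gnpWeight n p G * ∏ e ∈ G.edgeSet.toFinset, f e =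
      ∏ e ∈ (⊤ : SimpleGraph (Fin n)).edgeFinset, (p * f e + (1 - p)) := by
  have hsub (G : SimpleGraph (Fin n)) :
      G.edgeSet.toFinset ⊆ (⊤ : SimpleGraph (Fin n)).edgeFinset := by
    intro e he
    have he' : e ∈ G.edgeSet := by simpa using he
    have := SimpleGraph.edgeSet_mono (le_top : G ≤ ⊤) he'
    simpa using this
  rw [Finset.prod_add]
  refine Finset.sum_bij' (fun G _ => G.edgeSet.toFinset)
    (fun S _ => SimpleGraph.fromEdgeSet (S : Set (Sym2 (Fin n)))) ?_ ?_ ?_ ?_ ?_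
  · intro G _
    exact Finset.mem_powerset.2 (hsub G)
  · intro S _
    exact Finset.mem_univ _
  · intro G _
    simp
  · intro S hS
    rw [Finset.mem_powerset] at hS
    ext e
    have := @hS e
    simp only [SimpleGraph.mem_edgeFinset, SimpleGraph.edgeSet_top] at this
    simp only [Set.mem_toFinset, SimpleGraph.edgeSet_fromEdgeSet]
    constructor
    · rintro ⟨h, -⟩
      exact h
    · intro h
      exact ⟨h, this h⟩
  · intro G _
    have hcard : (⊤ : SimpleGraph (Fin n)).edgeFinset.card = n.choose 2 := by
      rw [SimpleGraph.card_edgeFinset_top_eq_card_choose_two, Fintype.card_fin]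
    rw [Finset.prod_mul_distrib, Finset.prod_const, Finset.prod_const,
      Finset.card_sdiff_of_subset (hsub G), hcard, gnpWeight, Set.ncard_eq_toFinset_card']
    ring

lemma sum_gnpWeight (n : ℕ) (p : ℝ) : ∑ G : SimpleGraph (Fin n), gnpWeight n p G = 1 := by
  simpa using sum_gnpWeight_mul_prod n p (fun _ => 1)

lemma eIn_eq_card_filter {n : ℕ} (G : SimpleGraph (Fin n)) (A : Set (Fin n)) :
    eIn G A = (G.edgeSet.toFinset.filter (fun e => ∀ v ∈ e, v ∈ A)).card := by
  rw [eIn, Set.ncard_eq_toFinset_card']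
  congr 1
  ext e
  simp

lemma eIn_mono {n : ℕ} {G H : SimpleGraph (Fin n)} (h : G ≤ H) (A : Set (Fin n)) :
    eIn G A ≤ eIn H A :=
  Set.ncard_le_ncard (fun _ he => ⟨SimpleGraph.edgeSet_mono h he.1, he.2⟩) (Set.toFinite _)

lemma eIn_top (n : ℕ) (A : Set (Fin n)) :
    eIn (⊤ : SimpleGraph (Fin n)) A = A.ncard.choose 2 := by
  rw [Set.ncard_eq_toFinset_card' A, ← Sym2.card_image_offDiag, eIn_eq_card_filter]
  congr 1
  ext e
  induction e using Sym2.ind with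
  | _ x y =>
    simp only [Finset.mem_filter, Set.mem_toFinset, SimpleGraph.mem_edgeSet, SimpleGraph.top_adj,
      Sym2.mem_iff, forall_eq_or_imp, forall_eq, Finset.mem_image, Finset.mem_offDiag,
      Prod.exists]
    constructor
    · rintro ⟨hne, hx, hy⟩
      exact ⟨x, y, ⟨hx, hy, hne⟩, rfl⟩
    · rintro ⟨a, b, ⟨ha, hb, hab⟩, h⟩
      rcases Sym2.eq_iff.1 h with ⟨rfl, rfl⟩ | ⟨rfl, rfl⟩
      · exact ⟨hab, ha, hb⟩
      · exact ⟨hab.symm, hb, ha⟩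

lemma eIn_le {n : ℕ} (G : SimpleGraph (Fin n)) (A : Set (Fin n)) :
    (eIn G A : ℝ) ≤ (A.ncard : ℝ) * ((A.ncard : ℝ) - 1) / 2 := by
  rw [← Nat.cast_choose_two, ← eIn_top]
  exact_mod_cast eIn_mono le_top A

/-- Bound on the moment generating function of the number of edges inside a set. -/
lemma sum_gnpWeight_mul_exp_le (n : ℕ) {p : ℝ} (hp : 0 ≤ p) (hp1 : p ≤ 1) (A : Set (Fin n))
    (θ : ℝ) :
    ∑ G : SimpleGraph (Fin n), gnpWeight n p G * Real.exp (θ * eIn G A) ≤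
      Real.exp (p * (Real.exp θ - 1) * (A.ncard.choose 2 : ℕ)) := by
  have key := sum_gnpWeight_mul_prod n p
    (fun e => if ∀ v ∈ e, v ∈ A then Real.exp θ else 1)
  have hexp (G : SimpleGraph (Fin n)) : Real.exp (θ * eIn G A) =
      ∏ e ∈ G.edgeSet.toFinset, if ∀ v ∈ e, v ∈ A then Real.exp θ else 1 := by
    rw [Finset.prod_ite, Finset.prod_const, Finset.prod_const_one, mul_one, ← Real.exp_nat_mul,
      eIn_eq_card_filter, mul_comm]
  simp only [hexp]
  rw [key]
  calc ∏ e ∈ (⊤ : SimpleGraph (Fin n)).edgeFinset,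
        (p * (if ∀ v ∈ e, v ∈ A then Real.exp θ else 1) + (1 - p))
      ≤ ∏ e ∈ (⊤ : SimpleGraph (Fin n)).edgeFinset,
        (if ∀ v ∈ e, v ∈ A then Real.exp (p * (Real.exp θ - 1)) else 1) := by
        refine Finset.prod_le_prod (fun e _ => ?_) (fun e _ => ?_)
        · have : 0 ≤ 1 - p := sub_nonneg.2 hp1
          split_ifs <;> positivity
        · split_ifs
          · linarith [Real.add_one_le_exp (p * (Real.exp θ - 1))]
          · linarith
    _ = Real.exp (p * (Real.exp θ - 1) * (A.ncard.choose 2 : ℕ)) := by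
        rw [Finset.prod_ite, Finset.prod_const, Finset.prod_const_one, mul_one,
          ← Real.exp_nat_mul, ← eIn_top, eIn_eq_card_filter, mul_comm]
        congr 4
        ext e
        simp

lemma gnpProb_not (n : ℕ) (p : ℝ) (P : SimpleGraph (Fin n) → Prop) :
    gnpProb n p (fun G => ¬ P G) = 1 - gnpProb n p P := by
  rw [eq_sub_iff_add_eq, gnpProb_eq_sum_gnpWeight, gnpProb_eq_sum_gnpWeight,
    ← Finset.sum_add_distrib, ← sum_gnpWeight n p]
  refine Finset.sum_congr rfl fun G _ => ?_
  by_cases h : P G <;> simp [h]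

/-- Union bound. -/
lemma gnpProb_exists_le {ι : Type*} [Fintype ι] (n : ℕ) {p : ℝ} (hp : 0 ≤ p) (hp1 : p ≤ 1)
    (P : ι → SimpleGraph (Fin n) → Prop) :
    gnpProb n p (fun G => ∃ i, P i G) ≤ ∑ i, gnpProb n p (P i) := by
  simp only [gnpProb_eq_sum_gnpWeight]
  rw [Finset.sum_comm]
  refine Finset.sum_le_sum fun G _ => ?_
  have hnn (i : ι) : 0 ≤ if P i G then gnpWeight n p G else 0 := by
    split_ifs
    exacts [gnpWeight_nonneg hp hp1 G, le_rfl]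
  split_ifs with h
  · obtain ⟨i, hi⟩ := h
    have := Finset.single_le_sum (f := fun i => if P i G then gnpWeight n p G else 0)
      (fun i _ => hnn i) (Finset.mem_univ i)
    simpa [hi] using this
  · exact Finset.sum_nonneg fun i _ => hnn i

/-- Chernoff bound for the number of edges inside a set. -/
lemma gnpProb_lt_eIn_le (n : ℕ) {p : ℝ} (hp : 0 ≤ p) (hp1 : p ≤ 1) (A : Set (Fin n))
    {θ : ℝ} (hθ : 0 ≤ θ) (t : ℝ) {P : SimpleGraph (Fin n) → Prop}
    (hP : ∀ G, P G → t < eIn G A) :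
    gnpProb n p P ≤
      Real.exp (p * (Real.exp θ - 1) * (A.ncard.choose 2 : ℕ) - θ * t) := by
  rw [sub_eq_add_neg, Real.exp_add]
  refine le_trans ?_ (mul_le_mul_of_nonneg_right (sum_gnpWeight_mul_exp_le n hp hp1 A θ)
    (Real.exp_pos _).le)
  rw [gnpProb_eq_sum_gnpWeight, Finset.sum_mul]
  refine Finset.sum_le_sum fun G _ => ?_
  have hw := gnpWeight_nonneg hp hp1 G
  split_ifs with h
  · rw [mul_assoc, ← Real.exp_add]
    refine le_mul_of_one_le_right hw (Real.one_le_exp ?_)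
    nlinarith [hP G h]
  · positivity

lemma exp_three_halves_le : Real.exp (3 / 2) ≤ 9 / 2 := by
  have h : Real.exp (3 / 2) ^ 2 = Real.exp 1 ^ 3 := by
    rw [← Real.exp_nat_mul, ← Real.exp_nat_mul]
    norm_num
  have h1 : Real.exp 1 ^ 3 ≤ 2.7182818286 ^ 3 :=
    pow_le_pow_left₀ (Real.exp_pos _).le Real.exp_one_lt_d9.le 3
  refine (pow_le_pow_iff_left₀ (Real.exp_pos _).le (by norm_num) two_ne_zero).1 ?_
  rw [h]
  exact h1.trans (by norm_num)

/-- `A` satisfies the required upper bounds on the number of edges of `G` inside it. -/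
def EdgeBound (n : ℕ) (p : ℝ) (A : Set (Fin n)) (G : SimpleGraph (Fin n)) : Prop :=
  (Real.log n / ((A.ncard : ℝ) * p) ≥ 7 / 4 →
    (eIn G A : ℝ) ≤ 3 / 2 * (A.ncard : ℝ) * Real.log n) ∧
  (Real.log n / ((A.ncard : ℝ) * p) ≤ 7 / 4 →
    (eIn G A : ℝ) ≤ 3 * (A.ncard : ℝ) ^ 2 * p)

lemma edgeBound_of_ncard_lt {n : ℕ} (hn : 21 ≤ Real.log n) {p : ℝ} (hp : 0 < p) (hp1 : p ≤ 1)
    {A : Set (Fin n)} (hA : A.ncard < 12) (G : SimpleGraph (Fin n)) : EdgeBound n p A G := by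
  have he := eIn_le G A
  have ha : (A.ncard : ℝ) < 12 := by exact_mod_cast hA
  have ha0 : (0 : ℝ) ≤ A.ncard := Nat.cast_nonneg _
  refine ⟨fun _ => by nlinarith, fun h => ?_⟩
  rcases ha0.eq_or_lt with h0 | h0
  · rw [← h0] at he ⊢
    simpa using he
  · rw [div_le_iff₀ (by positivity)] at h
    nlinarith

lemma gnpProb_not_edgeBound_le {n : ℕ} (hn : 21 ≤ Real.log n) {p : ℝ} (hp : 0 < p)
    (hp1 : p ≤ 1) (A : Set (Fin n)) :
    gnpProb n p (fun G => ¬ EdgeBound n p A G) ≤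
      Real.exp (-3 * Real.log n) * Real.exp (-Real.log n) ^ A.ncard := by
  rcases lt_or_ge A.ncard 12 with hA | hA
  · rw [gnpProb_eq_sum_gnpWeight, Finset.sum_eq_zero]
    · positivity
    · intro G _
      rw [if_neg (not_not.2 (edgeBound_of_ncard_lt hn hp hp1 hA G))]
  have ha : (12 : ℝ) ≤ A.ncard := by exact_mod_cast hA
  have hpos : 0 < (A.ncard : ℝ) * p := by positivity
  rw [← Real.exp_nat_mul, ← Real.exp_add]
  set a : ℝ := (A.ncard : ℝ)
  set L := Real.log n
  have hmean : p * (Real.exp (3 / 2) - 1) * (A.ncard.choose 2 : ℕ) ≤ 7 / 4 * (a * (a * p)) := by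
    rw [Nat.cast_choose_two]
    calc p * (Real.exp (3 / 2) - 1) * (a * (a - 1) / 2) ≤ p * (7 / 2) * (a * a / 2) := by
          gcongr
          · nlinarith
          · linarith [exp_three_halves_le]
          · linarith
      _ = 7 / 4 * (a * (a * p)) := by ring
  have haL : 12 * L ≤ a * L := by gcongr
  have hchernoff (t : ℝ) (hP : ∀ G, ¬ EdgeBound n p A G → t < eIn G A)
      (ht : 7 / 4 * (a * (a * p)) - 3 / 2 * t ≤ - (5 / 4) * (a * L)) :
      gnpProb n p (fun G => ¬ EdgeBound n p A G) ≤ Real.exp (-3 * L + a * -L) :=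
    (gnpProb_lt_eIn_le n hp.le hp1 A (by norm_num : (0 : ℝ) ≤ 3 / 2) t hP).trans
      (Real.exp_le_exp.2 (by linarith))
  rcases le_or_gt (7 / 4) (L / (a * p)) with h | h
  · have h' := (le_div_iff₀ hpos).1 h
    have h2 : a * (a * p) ≤ a * (4 / 7 * L) :=
      mul_le_mul_of_nonneg_left (by linarith) (by linarith)
    refine hchernoff (3 / 2 * a * L) (fun G hG => ?_) (by linarith)
    by_contra! hle
    refine hG ⟨fun _ => hle, fun h3 => hle.trans ?_⟩
    have h4 := (div_le_iff₀ hpos).1 h3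
    have h5 : a * L ≤ a * (7 / 4 * (a * p)) := by gcongr
    nlinarith
  · have h' := (div_lt_iff₀ hpos).1 h
    have h2 : a * L ≤ a * (7 / 4 * (a * p)) := by gcongr
    refine hchernoff (3 * a ^ 2 * p) (fun G hG => ?_) (by nlinarith)
    by_contra! hle
    exact hG ⟨fun h3 => absurd h3 h.not_ge, fun _ => hle⟩

lemma sum_pow_ncard (n : ℕ) (x : ℝ) : ∑ A : Set (Fin n), x ^ A.ncard = (1 + x) ^ n := by
  have h := Finset.sum_pow_mul_eq_add_pow x 1 (Finset.univ : Finset (Fin n))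
  simp only [one_pow, mul_one, Finset.card_univ, Fintype.card_fin, Finset.powerset_univ] at h
  rw [add_comm, ← h]
  refine Finset.sum_bij' (fun A _ => A.toFinset) (fun s _ => (s : Set (Fin n))) ?_ ?_ ?_ ?_ ?_
  all_goals simp [Set.ncard_eq_toFinset_card']

end EDHC

open EDHC in
/-- Lemma 4.4: edge counts inside sets in `G_{n,p}`. -/
theorem stmt_5 :
    ∃ N : ℕ, ∀ n : ℕ, N ≤ n → ∀ p : ℝ, 0 < p → p ≤ 1 →
      1 - 1 / (n : ℝ) ^ 2 ≤ gnpProb n p (fun G =>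
        ∀ A : Set (Fin n),
          (Real.log n / ((A.ncard : ℝ) * p) ≥ 7 / 4 →
            (eIn G A : ℝ) ≤ 3 / 2 * (A.ncard : ℝ) * Real.log n) ∧
          (Real.log n / ((A.ncard : ℝ) * p) ≤ 7 / 4 →
            (eIn G A : ℝ) ≤ 3 * (A.ncard : ℝ) ^ 2 * p)) := by
  obtain ⟨N, hN⟩ := exists_nat_ge (Real.exp 21)
  refine ⟨N, fun n hn p hp hp1 => ?_⟩
  have hexp : Real.exp 21 ≤ n := hN.trans (by exact_mod_cast hn)
  have hn0 : (0 : ℝ) < n := (Real.exp_pos _).trans_le hexp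
  have hlog : 21 ≤ Real.log n := (Real.le_log_iff_exp_le hn0).2 hexp
  have hn3 : (3 : ℝ) ≤ n := by linarith [Real.add_one_le_exp 21]
  have h := gnpProb_not n p (fun G => ∀ A : Set (Fin n), EdgeBound n p A G)
  simp only [not_forall] at h
  have hbad := (gnpProb_exists_le n hp.le hp1 (fun A G => ¬ EdgeBound n p A G)).trans
    (Finset.sum_le_sum fun A _ => gnpProb_not_edgeBound_le hlog hp hp1 A)
  rw [h, ← Finset.mul_sum, sum_pow_ncard] at hbad
  have hinv : Real.exp (-Real.log n) = (n : ℝ)⁻¹ := by rw [Real.exp_neg, Real.exp_log hn0]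
  have hinv3 : Real.exp (-3 * Real.log n) = ((n : ℝ) ^ 3)⁻¹ := by
    rw [neg_mul, Real.exp_neg]
    congr 1
    rw [← Real.exp_log hn0, ← Real.exp_nat_mul, Real.log_exp]
    norm_num
  have hpow : (1 + (n : ℝ)⁻¹) ^ n ≤ n := by
    calc (1 + (n : ℝ)⁻¹) ^ n ≤ Real.exp (n : ℝ)⁻¹ ^ n := by
          gcongr
          linarith [Real.add_one_le_exp (n : ℝ)⁻¹]
      _ = Real.exp 1 := by rw [← Real.exp_nat_mul, mul_inv_cancel₀ hn0.ne']
      _ ≤ n := by linarith [Real.exp_one_lt_d9]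
  rw [hinv, hinv3] at hbad
  have hfinal : ((n : ℝ) ^ 3)⁻¹ * (1 + (n : ℝ)⁻¹) ^ n ≤ 1 / (n : ℝ) ^ 2 := by
    calc ((n : ℝ) ^ 3)⁻¹ * (1 + (n : ℝ)⁻¹) ^ n ≤ ((n : ℝ) ^ 3)⁻¹ * n := by gcongr
      _ = 1 / (n : ℝ) ^ 2 := by field_simp
  have hgood : 1 - 1 / (n : ℝ) ^ 2 ≤
      gnpProb n p (fun G => ∀ A : Set (Fin n), EdgeBound n p A G) := by linarith
  exact hgood
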